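/- arXiv:math/0611805 — 2 statements merged into one kernel-verified Lean document; each statement's English description precedes it below -/
import Mathlib

section
/- Let {a_n}_{n≥1} be a nonnegative real sequence which is a mean value bounded variation sequence (MVBVS), and suppose the sine series ∑_{n=1}^∞ a_n sin(nx) converges pointwise on ℝ to a function f that is continuous (and 2π-periodic). Then lim_{n→∞} n·a_n = 0. -/
open Filter

/-- A nonnegative sequence (indexed from 1) is a mean value bounded variation sequence. -/
def IsMVBVS (a : ℕ → ℝ) : Prop :=
  ∃ lam : ℝ, 2 ≤ lam ∧ ∃ C : ℝ, 0 < C ∧ ∀ n : ℕ, 1 ≤ n →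
    ∑ k ∈ Finset.Icc n (2 * n), |a k - a (k + 1)| ≤
      (C / n) * ∑ k ∈ Finset.Icc ⌊(n : ℝ) / lam⌋₊ ⌊lam * n⌋₊, a k

lemma aux_deriv_bound {x : ℝ} (hx : 0 < x) :
    |2 * (Real.sin x / x) * ((Real.cos x * x - Real.sin x) / x ^ 2)| ≤ 16 / (1 + x) ^ 2 := by
  have h1 : |Real.sin x| ≤ x := by
    have := @Real.abs_sin_le_abs x
    rwa [abs_of_pos hx] at this
  have h1' := Real.abs_sin_le_one x
  have hc' := Real.abs_cos_le_one x
  rw [abs_mul, abs_mul, abs_div, abs_div, abs_of_pos hx, abs_of_pos (pow_pos hx 2), abs_two]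
  rcases le_or_gt x 1 with h | h
  · have ha : |Real.sin x| / x ≤ 1 := by rw [div_le_one hx]; exact h1
    have hb : |Real.cos x * x - Real.sin x| / x ^ 2 ≤ 1 := by
      rw [div_le_one (by positivity), abs_le]
      have e1 := @Real.one_sub_sq_div_two_le_cos x
      have e2 := Real.cos_le_one x
      have e3 := Real.sin_lt hx
      have e4 := Real.sin_gt_sub_cube hx
      have e5 : x ^ 3 ≤ x ^ 2 := pow_le_pow_of_le_one hx.le h (by norm_num)
      constructor
      · nlinarith
      · nlinarith
    have hd : (4 : ℝ) ≤ 16 / (1 + x) ^ 2 := by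
      rw [le_div_iff₀ (by positivity)]; nlinarith
    have : 2 * (|Real.sin x| / x) * (|Real.cos x * x - Real.sin x| / x ^ 2) ≤ 2 * 1 * 1 := by
      gcongr
    linarith
  · have ha : |Real.sin x| / x ≤ 1 / x := by gcongr
    have hb : |Real.cos x * x - Real.sin x| / x ^ 2 ≤ 2 / x := by
      rw [div_le_div_iff₀ (by positivity) hx]
      have : |Real.cos x * x - Real.sin x| ≤ 2 * x := by
        rw [abs_le] at *
        constructor <;> nlinarith
      nlinarith
    have : 2 * (|Real.sin x| / x) * (|Real.cos x * x - Real.sin x| / x ^ 2)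
        ≤ 2 * (1 / x) * (2 / x) := by
      gcongr
    refine this.trans ?_
    rw [show 2 * (1 / x) * (2 / x) = 4 / x ^ 2 by field_simp; norm_num,
      div_le_div_iff₀ (by positivity) (by positivity)]
    nlinarith

lemma aux_hasDeriv {x : ℝ} (hx : 0 < x) :
    HasDerivAt (fun y => Real.sinc y ^ 2)
      (2 * (Real.sin x / x) * ((Real.cos x * x - Real.sin x) / x ^ 2)) x := by
  have h : HasDerivAt (fun y => (Real.sin y / y) ^ 2)
      (2 * (Real.sin x / x) * ((Real.cos x * x - Real.sin x) / x ^ 2)) x := by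
    have := ((Real.hasDerivAt_sin x).fun_div (hasDerivAt_id' x) hx.ne').fun_pow 2
    refine this.congr_deriv ?_
    simp
  refine h.congr_of_eventuallyEq ?_
  filter_upwards [lt_mem_nhds hx] with y hy
  rw [Real.sinc_of_ne_zero (ne_of_gt hy)]

lemma aux_hasDeriv_w {x : ℝ} (hx : 0 < x) :
    HasDerivAt (fun y : ℝ => 16 / (1 + y)) (-(16 / (1 + x) ^ 2)) x := by
  have := (hasDerivAt_const x (16 : ℝ)).fun_div ((hasDerivAt_id' x).const_add 1)
    (show (1 + x) ≠ 0 by positivity)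
  refine this.congr_deriv ?_
  simp; ring

lemma aux_cont_w : ContinuousOn (fun y : ℝ => 16 / (1 + y)) (Set.Ici 0) := by
  apply ContinuousOn.div (by fun_prop) (by fun_prop)
  intro x hx
  have : (0 : ℝ) ≤ x := hx
  positivity

lemma aux_diff {x y : ℝ} (hx : 0 ≤ x) (hxy : x ≤ y) :
    |Real.sinc y ^ 2 - Real.sinc x ^ 2| ≤ 16 / (1 + x) - 16 / (1 + y) := by
  have hs : ContinuousOn (fun y => Real.sinc y ^ 2) (Set.Ici 0) :=
    (Real.continuous_sinc.pow 2).continuousOn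
  have h1 : AntitoneOn (fun y => 16 / (1 + y) + Real.sinc y ^ 2) (Set.Ici 0) := by
    apply antitoneOn_of_deriv_nonpos (convex_Ici 0) (aux_cont_w.add hs)
    · intro z hz
      rw [interior_Ici] at hz
      exact ((aux_hasDeriv_w hz).fun_add (aux_hasDeriv hz)).differentiableAt.differentiableWithinAt
    · intro z hz
      rw [interior_Ici] at hz
      rw [((aux_hasDeriv_w hz).add (aux_hasDeriv hz)).deriv]
      have := (abs_le.1 (aux_deriv_bound hz)).2
      linarith
  have h2 : AntitoneOn (fun y => 16 / (1 + y) - Real.sinc y ^ 2) (Set.Ici 0) := by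
    apply antitoneOn_of_deriv_nonpos (convex_Ici 0) (aux_cont_w.sub hs)
    · intro z hz
      rw [interior_Ici] at hz
      exact ((aux_hasDeriv_w hz).fun_sub (aux_hasDeriv hz)).differentiableAt.differentiableWithinAt
    · intro z hz
      rw [interior_Ici] at hz
      rw [((aux_hasDeriv_w hz).sub (aux_hasDeriv hz)).deriv]
      have := (abs_le.1 (aux_deriv_bound hz)).1
      linarith
  have k1 := h1 (show x ∈ Set.Ici 0 from hx) (show y ∈ Set.Ici 0 from hx.trans hxy) hxy
  have k2 := h2 (show x ∈ Set.Ici 0 from hx) (show y ∈ Set.Ici 0 from hx.trans hxy) hxy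
  simp only at k1 k2
  rw [abs_le]
  constructor <;> linarith

lemma aux_sinc_sq_le (x : ℝ) : |Real.sinc x ^ 2| ≤ 1 := by
  rw [abs_pow]
  exact pow_le_one₀ (abs_nonneg _) (Real.abs_sinc_le_one x)

lemma aux_abel (c u : ℕ → ℝ) (s : ℝ) (n : ℕ) :
    ∑ k ∈ Finset.range n, c k * u k - s * u 0 =
      (∑ k ∈ Finset.range n, c k - s) * u n -
        ∑ k ∈ Finset.range n, (∑ j ∈ Finset.range (k + 1), c j - s) * (u (k + 1) - u k) := by
  induction n with
  | zero => simp
  | succ n ih =>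
    rw [Finset.sum_range_succ, Finset.sum_range_succ _ n, Finset.sum_range_succ _ n]
    rw [Finset.sum_range_succ] at *
    linear_combination ih

lemma riemann_first (c : ℕ → ℝ) (s : ℝ)
    (hc : Tendsto (fun n => ∑ k ∈ Finset.range n, c k) atTop (nhds s))
    (hs : ∀ h : ℝ, 0 < h → Summable fun n : ℕ => c n * Real.sinc (n * h) ^ 2) :
    Tendsto (fun h : ℝ => ∑' n : ℕ, c n * Real.sinc (n * h) ^ 2) (nhdsWithin 0 (Set.Ioi 0))
      (nhds s) := by
  have hR : Tendsto (fun n => ∑ k ∈ Finset.range n, c k - s) atTop (nhds 0) := by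
    simpa using hc.sub_const s
  obtain ⟨B, hB⟩ : ∃ B, ∀ n, |∑ k ∈ Finset.range n, c k - s| ≤ B := by
    obtain ⟨B, hB⟩ := (Metric.isBounded_range_of_tendsto _ hR).exists_norm_le
    exact ⟨B, fun n => hB _ ⟨n, rfl⟩⟩
  have hB0 : 0 ≤ B := (abs_nonneg _).trans (hB 0)
  rw [Metric.tendsto_nhds]
  intro e he
  set ε := e / 40 with hε
  have hε0 : 0 < ε := by positivity
  obtain ⟨N, hN⟩ := Metric.tendsto_atTop.1 hR ε hε0
  have hN' : ∀ n ≥ N, |∑ k ∈ Finset.range n, c k - s| ≤ ε := by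
    intro n hn
    have := hN n hn
    rw [Real.dist_eq, sub_zero] at this
    exact this.le
  have hd : (0 : ℝ) < e / (40 * (B * N + 1)) := by positivity
  filter_upwards [Ioo_mem_nhdsGT hd] with h hh
  have h0 : 0 < h := hh.1
  have key : ∀ n ≥ N, |∑ k ∈ Finset.range n, c k * Real.sinc (k * h) ^ 2 - s|
      ≤ ε + (16 * ε + B * (16 * (N * h))) := by
    intro n hn
    have e1 := aux_abel c (fun k => Real.sinc (k * h) ^ 2) s n
    simp only [Nat.cast_zero, zero_mul, Real.sinc_zero, one_pow, mul_one] at e1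
    rw [e1]
    refine (abs_sub _ _).trans (add_le_add ?_ ?_)
    · rw [abs_mul]
      calc _ ≤ ε * 1 := mul_le_mul (hN' n hn) (aux_sinc_sq_le _) (abs_nonneg _) hε0.le
        _ = ε := mul_one _
    · have step : ∀ k : ℕ, |Real.sinc (((k + 1 : ℕ) : ℝ) * h) ^ 2 - Real.sinc (k * h) ^ 2|
          ≤ 16 / (1 + k * h) - 16 / (1 + ((k + 1 : ℕ) : ℝ) * h) := by
        intro k
        apply aux_diff (by positivity)
        push_cast; nlinarith
      have step0 : ∀ k : ℕ, 0 ≤ 16 / (1 + k * h) - 16 / (1 + ((k + 1 : ℕ) : ℝ) * h) :=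
        fun k => (abs_nonneg _).trans (step k)
      have tele : ∀ m : ℕ, ∑ k ∈ Finset.range m,
          (16 / (1 + k * h) - 16 / (1 + ((k + 1 : ℕ) : ℝ) * h)) = 16 - 16 / (1 + m * h) := by
        intro m
        rw [Finset.sum_range_sub' (fun k : ℕ => 16 / (1 + (k : ℝ) * h))]
        simp
      calc _ ≤ ∑ k ∈ Finset.range n, |(∑ j ∈ Finset.range (k + 1), c j - s) *
              (Real.sinc (((k + 1 : ℕ) : ℝ) * h) ^ 2 - Real.sinc (k * h) ^ 2)| :=
            Finset.abs_sum_le_sum_abs _ _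
        _ ≤ ∑ k ∈ Finset.range n, (ε * (16 / (1 + k * h) - 16 / (1 + ((k + 1 : ℕ) : ℝ) * h))
              + if k < N then B * (16 / (1 + k * h) - 16 / (1 + ((k + 1 : ℕ) : ℝ) * h)) else 0) := by
            apply Finset.sum_le_sum
            intro k _
            rw [abs_mul]
            split_ifs with hk
            · have : |∑ j ∈ Finset.range (k + 1), c j - s| *
                  |Real.sinc (((k + 1 : ℕ) : ℝ) * h) ^ 2 - Real.sinc (k * h) ^ 2| ≤
                  B * (16 / (1 + k * h) - 16 / (1 + ((k + 1 : ℕ) : ℝ) * h)) :=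
                mul_le_mul (hB _) (step k) (abs_nonneg _) hB0
              have := mul_nonneg hε0.le (step0 k)
              linarith
            · rw [add_zero]
              exact mul_le_mul (hN' _ (by omega)) (step k) (abs_nonneg _) hε0.le
        _ ≤ 16 * ε + B * (16 * (N * h)) := by
            rw [Finset.sum_add_distrib, ← Finset.mul_sum, tele, ← Finset.sum_filter,
              show (Finset.range n).filter (· < N) = Finset.range N by
                ext k; simp; omega, ← Finset.mul_sum, tele]
            have p1 : 0 ≤ 16 / (1 + (n : ℝ) * h) := by positivity
            have p2 : 16 - 16 / (1 + (N : ℝ) * h) ≤ 16 * (N * h) := by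
              have hNh : 0 ≤ (N : ℝ) * h := by positivity
              rw [sub_le_iff_le_add, ← sub_le_iff_le_add', le_div_iff₀ (by positivity)]
              nlinarith
            have := mul_le_mul_of_nonneg_left p2 hB0
            nlinarith
  have lim := ((hs h h0).hasSum.tendsto_sum_nat.sub_const s).abs
  have fin := le_of_tendsto lim (eventually_atTop.2 ⟨N, key⟩)
  rw [Real.dist_eq]
  refine fin.trans_lt ?_
  have h2 := hh.2
  rw [lt_div_iff₀ (by positivity)] at h2
  have : 0 ≤ B * N := by positivity
  nlinarith

lemma midpoint_convex (G : ℝ → ℝ) (hG : Continuous G) (m t : ℝ) (ht : 0 < t)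
    (hD : ∀ x ∈ Set.Ioo (m - t) (m + t), ∃ L > 0,
      Tendsto (fun h => (G (x + 2 * h) + G (x - 2 * h) - 2 * G x) / (4 * h ^ 2))
        (nhdsWithin 0 (Set.Ioi 0)) (nhds L)) :
    0 ≤ G (m + t) + G (m - t) - 2 * G m := by
  by_contra hcon
  push Not at hcon
  set α := (G (m + t) - G (m - t)) / (2 * t) with hα
  set H : ℝ → ℝ := fun x => G x - α * (x - m) with hH
  have hHc : Continuous H := by fun_prop
  have hαt : α * t = (G (m + t) - G (m - t)) / 2 := by rw [hα]; field_simp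
  obtain ⟨y, hy, hmax⟩ := isCompact_Icc.exists_isMaxOn
    (show (Set.Icc (m - t) (m + t)).Nonempty from ⟨m, by constructor <;> linarith⟩) hHc.continuousOn
  have hm := hmax (show m ∈ Set.Icc (m - t) (m + t) by constructor <;> linarith)
  simp only [Set.mem_ofPred_eq, hH] at hm
  have hy' : y ∈ Set.Ioo (m - t) (m + t) := by
    refine ⟨lt_of_le_of_ne hy.1 ?_, lt_of_le_of_ne hy.2 ?_⟩
    · intro h; rw [← h] at hm; nlinarith
    · intro h; rw [h] at hm; nlinarith
  obtain ⟨L, hL, hlim⟩ := hD y hy'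
  have : L ≤ 0 := by
    refine le_of_tendsto hlim ?_
    have hd : 0 < min (y - (m - t)) (m + t - y) / 2 := by
      have := hy'.1; have := hy'.2
      apply div_pos (lt_min (by linarith) (by linarith)) two_pos
    filter_upwards [Ioo_mem_nhdsGT hd] with h hh
    have q1 := min_le_left (y - (m - t)) (m + t - y)
    have q2 := min_le_right (y - (m - t)) (m + t - y)
    have q3 := hh.1
    have q4 := hh.2
    have a1 := hmax (show y + 2 * h ∈ Set.Icc (m - t) (m + t) by constructor <;> linarith)
    have a2 := hmax (show y - 2 * h ∈ Set.Icc (m - t) (m + t) by constructor <;> linarith)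
    simp only [Set.mem_ofPred_eq, hH] at a1 a2
    apply div_nonpos_of_nonpos_of_nonneg
    · nlinarith
    · positivity
  linarith

lemma cantor_lebesgue (a : ℕ → ℝ)
    (h : ∀ x : ℝ, Tendsto (fun n : ℕ => a n * Real.sin (n * x)) atTop (nhds 0)) :
    Tendsto a atTop (nhds 0) := by
  by_contra hcon
  rw [Metric.tendsto_atTop] at hcon
  push Not at hcon
  obtain ⟨δ, hδ, hN⟩ := hcon
  choose φ hφ hφ2 using fun N : ℕ => hN (N + 1)
  have hφt : Tendsto φ atTop atTop :=
    tendsto_atTop_mono (fun n => (Nat.le_succ n).trans (hφ n)) tendsto_id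
  have hs : ∀ x : ℝ, Tendsto (fun n : ℕ => Real.sin (φ n * x) ^ 2) atTop (nhds 0) := by
    intro x
    have h1 : Tendsto (fun n => (a (φ n) * Real.sin (φ n * x)) ^ 2 / δ ^ 2) atTop (nhds 0) := by
      have := (((h x).comp hφt).pow 2).div_const (δ ^ 2)
      simpa using this
    refine squeeze_zero (fun n => sq_nonneg _) (fun n => ?_) h1
    rw [le_div_iff₀ (by positivity), mul_pow, mul_comm]
    have : δ ≤ |a (φ n)| := by simpa [Real.dist_eq] using hφ2 n
    have : δ ^ 2 ≤ a (φ n) ^ 2 := by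
      rw [← sq_abs (a (φ n))]; gcongr
    gcongr
  have hint := intervalIntegral.tendsto_integral_filter_of_dominated_convergence
    (μ := MeasureTheory.volume) (a := 0) (b := 2 * Real.pi) (l := atTop)
    (F := fun n : ℕ => fun x : ℝ => Real.sin (φ n * x) ^ 2) (f := fun _ => (0 : ℝ)) (fun _ => (1 : ℝ))
    (Eventually.of_forall fun n => Continuous.aestronglyMeasurable (by fun_prop))
    (Eventually.of_forall fun n => Eventually.of_forall fun x _ => by
      rw [Real.norm_eq_abs, abs_pow]
      exact pow_le_one₀ (abs_nonneg _) (Real.abs_sin_le_one _))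
    (by simp) (Eventually.of_forall fun x _ => hs x)
  have hval : ∀ n : ℕ, ∫ x in (0 : ℝ)..(2 * Real.pi), Real.sin (φ n * x) ^ 2 = Real.pi := by
    intro n
    have hp : (φ n : ℝ) ≠ 0 := by
      have := hφ n
      exact Nat.cast_ne_zero.2 (by omega)
    rw [intervalIntegral.integral_comp_mul_left (fun x => Real.sin x ^ 2) hp, integral_sin_sq]
    have : Real.sin (φ n * (2 * Real.pi)) = 0 := by
      have := Real.sin_nat_mul_pi (φ n * 2)
      push_cast at this
      rw [← this]; ring_nf
    rw [this]
    simp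
    field_simp
  simp only [hval] at hint
  simp only [intervalIntegral.integral_zero] at hint
  exact Real.pi_ne_zero (tendsto_nhds_unique tendsto_const_nhds hint)

lemma aux_cast {F G : ℕ → ℝ} {s r : ℝ} (h : HasSum F s) (h1 : ∀ n, G n = F n) (h2 : r = s) :
    HasSum G r := by
  have : G = F := funext h1
  rw [this, h2]; exact h

lemma aux_term (α x h : ℝ) (hh : 0 < h) (n : ℕ) :
    α / (n : ℝ) ^ 2 * Real.sin (n * (x + 2 * h)) + α / (n : ℝ) ^ 2 * Real.sin (n * (x - 2 * h))
      - 2 * (α / (n : ℝ) ^ 2 * Real.sin (n * x))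
    = -(4 * h ^ 2) * (α * Real.sin (n * x) * Real.sinc (n * h) ^ 2) := by
  rcases Nat.eq_zero_or_pos n with rfl | hn
  · simp
  have hn' : (0 : ℝ) < n := Nat.cast_pos.2 hn
  rw [Real.sinc_of_ne_zero (by positivity)]
  have e : Real.sin (n * (x + 2 * h)) + Real.sin (n * (x - 2 * h)) - 2 * Real.sin (n * x)
      = - 4 * Real.sin (n * x) * Real.sin (n * h) ^ 2 := by
    rw [show (n : ℝ) * (x + 2 * h) = n * x + 2 * (n * h) by ring,
      show (n : ℝ) * (x - 2 * h) = n * x - 2 * (n * h) by ring, Real.sin_add, Real.sin_sub,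
      Real.cos_two_mul, Real.cos_sq']
    ring
  have : α / (n : ℝ) ^ 2 * Real.sin (n * (x + 2 * h)) +
      α / (n : ℝ) ^ 2 * Real.sin (n * (x - 2 * h)) - 2 * (α / (n : ℝ) ^ 2 * Real.sin (n * x))
      = α / (n : ℝ) ^ 2 * (- 4 * Real.sin (n * x) * Real.sin (n * h) ^ 2) := by
    rw [← e]; ring
  rw [this]
  field_simp

lemma aux_integral (n : ℕ) (s : ℝ) :
    ∫ t in (0 : ℝ)..s, (2 * Real.sin (n * t) - Real.sin (n * (2 * t)))
      = (1 - Real.cos (n * s)) ^ 2 / n := by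
  rcases Nat.eq_zero_or_pos n with rfl | hn
  · simp
  have hn' : (n : ℝ) ≠ 0 := by positivity
  have hd : ∀ t ∈ Set.uIcc 0 s, HasDerivAt (fun t : ℝ => (1 - Real.cos (n * t)) ^ 2 / n)
      (2 * Real.sin (n * t) - Real.sin (n * (2 * t))) t := by
    intro t _
    have h1 : HasDerivAt (fun t : ℝ => Real.cos (n * t)) (-Real.sin (n * t) * n) t := by
      simpa using ((hasDerivAt_id' t).const_mul (n : ℝ)).cos
    have := ((h1.const_sub 1).fun_pow 2).div_const (n : ℝ)
    refine this.congr_deriv ?_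
    rw [show (n : ℝ) * (2 * t) = 2 * (n * t) by ring, Real.sin_two_mul]
    field_simp
    simp
    ring
  rw [intervalIntegral.integral_eq_sub_of_hasDerivAt hd
    (Continuous.intervalIntegrable (by fun_prop) _ _)]
  simp

lemma key_sum (a : ℕ → ℝ) (ha : ∀ n : ℕ, 1 ≤ n → 0 ≤ a n) (f : ℝ → ℝ)
    (hpt : ∀ x : ℝ,
      Tendsto (fun n : ℕ => ∑ k ∈ Finset.Icc 1 n, a k * Real.sin (k * x))
        atTop (nhds (f x)))
    (hf : Continuous f) (ε : ℝ) (hε : 0 < ε) :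
    ∃ M0 : ℕ, ∀ M : ℕ, M0 ≤ M → ∑ n ∈ Finset.Icc 1 M, (n : ℝ) * a n ≤ ε * M := by
  have hconv : ∀ x : ℝ, Tendsto (fun n : ℕ => ∑ k ∈ Finset.range n, a k * Real.sin (k * x))
      atTop (nhds (f x)) := by
    intro x
    rw [← tendsto_add_atTop_iff_nat 1]
    refine (hpt x).congr fun n => ?_
    apply Finset.sum_subset
    · intro k hk
      simp at hk ⊢; omega
    · intro k hk hk'
      have : k = 0 := by simp at hk hk'; omega
      subst this; simp
  have hf0 : f 0 = 0 := by
    refine tendsto_nhds_unique (hpt 0) ?_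
    simp
  have hlim : Tendsto a atTop (nhds 0) := by
    apply cantor_lebesgue
    intro x
    have := ((tendsto_add_atTop_iff_nat 1).2 (hconv x)).sub (hconv x)
    simpa [Finset.sum_range_succ] using this
  obtain ⟨A, hA⟩ : ∃ A, ∀ n, |a n| ≤ A := by
    obtain ⟨B, hB⟩ := (Metric.isBounded_range_of_tendsto _ hlim).exists_norm_le
    exact ⟨B, fun n => hB _ ⟨n, rfl⟩⟩
  have hA0 : 0 ≤ A := (abs_nonneg _).trans (hA 0)
  have hsumA : Summable fun n : ℕ => A / (n : ℝ) ^ 2 := by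
    simpa [div_eq_mul_inv] using (Real.summable_nat_pow_inv.2 (by norm_num : 1 < 2)).mul_left A
  have hbd : ∀ (n : ℕ) (x : ℝ), ‖a n / (n : ℝ) ^ 2 * Real.sin (n * x)‖ ≤ A / (n : ℝ) ^ 2 := by
    intro n x
    rw [Real.norm_eq_abs, abs_mul, abs_div, abs_of_nonneg (by positivity : (0 : ℝ) ≤ (n : ℝ) ^ 2)]
    calc _ ≤ A / (n : ℝ) ^ 2 * 1 := by
          gcongr
          · exact hA n
          · exact Real.abs_sin_le_one _
      _ = _ := mul_one _
  set E : ℝ → ℝ := fun x => ∑' n : ℕ, a n / (n : ℝ) ^ 2 * Real.sin (n * x) with hE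
  have hEs : ∀ x, HasSum (fun n : ℕ => a n / (n : ℝ) ^ 2 * Real.sin (n * x)) (E x) := fun x =>
    (Summable.of_norm_bounded hsumA (fun n => hbd n x)).hasSum
  have hEc : Continuous E := continuous_tsum (fun n => by fun_prop) hsumA hbd
  have hsec : ∀ x h : ℝ, 0 < h → HasSum (fun n : ℕ => a n * Real.sin (n * x) *
      Real.sinc (n * h) ^ 2) (-((E (x + 2 * h) + E (x - 2 * h) - 2 * E x) / (4 * h ^ 2))) := by
    intro x h hh
    have h1 := (((hEs (x + 2 * h)).add (hEs (x - 2 * h))).sub ((hEs x).mul_left 2))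
    simp only [aux_term _ _ _ hh] at h1
    have h2 := h1.mul_left (-(4 * h ^ 2))⁻¹
    refine aux_cast h2 ?_ ?_
    · intro n
      have : -(4 * h ^ 2) ≠ 0 := by
        have : 0 < 4 * h ^ 2 := by positivity
        linarith
      rw [inv_mul_cancel_left₀ this]
    · rw [inv_neg, div_eq_inv_mul]; ring
  have hschw : ∀ x, Tendsto (fun h => (E (x + 2 * h) + E (x - 2 * h) - 2 * E x) / (4 * h ^ 2))
      (nhdsWithin 0 (Set.Ioi 0)) (nhds (-f x)) := by
    intro x
    have h1 := (riemann_first _ _ (hconv x) (fun h hh => (hsec x h hh).summable)).neg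
    refine h1.congr' ?_
    filter_upwards [self_mem_nhdsWithin] with h hh
    rw [(hsec x h hh).tsum_eq, neg_neg]
  -- near zero
  set η := ε / 16 with hη
  have hη0 : 0 < η := by positivity
  obtain ⟨δ, hδ, hfδ⟩ := Metric.continuousAt_iff.1 (hf.continuousAt (x := 0)) η hη0
  have hP : ∀ t, 0 < t → 2 * t < δ → 2 * E t - E (2 * t) ≤ η * t ^ 2 := by
    intro t ht htδ
    have := midpoint_convex (fun x => E x + η * x ^ 2 / 2) (by fun_prop) t t ht ?_
    · have hE0 : E 0 = 0 := by simp [hE]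
      simp only [sub_self, hE0, ← two_mul] at this
      nlinarith
    · intro x hx
      have hx1 := hx.1
      have hx2 := hx.2
      have hfx := hfδ (show dist x 0 < δ by
        rw [Real.dist_eq, sub_zero, abs_lt]; constructor <;> linarith)
      rw [hf0, Real.dist_eq, sub_zero, abs_lt] at hfx
      refine ⟨-f x + η, by linarith [hfx.2], ?_⟩
      refine ((hschw x).add_const η).congr' ?_
      filter_upwards [self_mem_nhdsWithin] with h hh
      have : (0 : ℝ) < h := hh
      field_simp
      ring
  have hPs : ∀ t, HasSum (fun n : ℕ => a n / (n : ℝ) ^ 2 *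
      (2 * Real.sin (n * t) - Real.sin (n * (2 * t)))) (2 * E t - E (2 * t)) := by
    intro t
    refine aux_cast (((hEs t).mul_left 2).sub (hEs (2 * t))) ?_ rfl
    intro n; ring
  have hI : ∀ s, 0 < s → 2 * s < δ →
      ∃ S ≤ η * s ^ 3, HasSum (fun n : ℕ => a n / (n : ℝ) ^ 3 * (1 - Real.cos (n * s)) ^ 2) S := by
    intro s hs hsδ
    refine ⟨∫ t in (0 : ℝ)..s, (2 * E t - E (2 * t)), ?_, ?_⟩
    · have h1 : ∫ t in (0 : ℝ)..s, (2 * E t - E (2 * t)) ≤ ∫ t in (0 : ℝ)..s, η * t ^ 2 := by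
        apply intervalIntegral.integral_mono_on_of_le_Ioo hs.le
        · exact Continuous.intervalIntegrable (by fun_prop) _ _
        · exact Continuous.intervalIntegrable (by fun_prop) _ _
        · intro t ht
          exact hP t ht.1 (by linarith [ht.2])
      refine h1.trans ?_
      rw [intervalIntegral.integral_const_mul, integral_pow]
      have : 0 < s ^ 3 := by positivity
      norm_num
      nlinarith
    · have h2 := intervalIntegral.hasSum_integral_of_dominated_convergence
        (μ := MeasureTheory.volume) (a := 0) (b := s)
        (F := fun n : ℕ => fun t : ℝ => a n / (n : ℝ) ^ 2 *
          (2 * Real.sin (n * t) - Real.sin (n * (2 * t))))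
        (f := fun t => 2 * E t - E (2 * t))
        (fun n _ => 3 * (A / (n : ℝ) ^ 2))
        (fun n => Continuous.aestronglyMeasurable (by fun_prop))
        (fun n => Eventually.of_forall fun t _ => by
          have e1 := hbd n t
          have e2 := hbd n (2 * t)
          rw [Real.norm_eq_abs, abs_le] at *
          constructor <;> linarith [e1.1, e1.2, e2.1, e2.2])
        (Eventually.of_forall fun t _ => hsumA.mul_left 3)
        (by simp)
        (Eventually.of_forall fun t _ => hPs t)
      refine aux_cast h2 ?_ rfl
      intro n
      rw [intervalIntegral.integral_const_mul, aux_integral]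
      rcases Nat.eq_zero_or_pos n with rfl | hn
      · simp
      have hn' : (0 : ℝ) < n := Nat.cast_pos.2 hn
      field_simp
  obtain ⟨M0, hM0⟩ := exists_nat_gt (2 / δ)
  refine ⟨M0 + 1, fun M hM => ?_⟩
  have hMpos : (0 : ℝ) < M := Nat.cast_pos.2 (by omega)
  have hMδ : 2 * (1 / (M : ℝ)) < δ := by
    have : (M0 : ℝ) < M := by exact_mod_cast (by omega : M0 < M)
    have h3 : 2 / δ < M := hM0.trans this
    rw [div_lt_iff₀ hδ] at h3
    rw [mul_one_div, div_lt_iff₀ hMpos]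
    linarith
  obtain ⟨S, hS, hsum⟩ := hI (1 / M) (by positivity) hMδ
  have hle : ∑ n ∈ Finset.Icc 1 M, a n / (n : ℝ) ^ 3 * (1 - Real.cos (n * (1 / M))) ^ 2 ≤ S := by
    apply sum_le_hasSum _ _ hsum
    intro n _
    rcases Nat.eq_zero_or_pos n with rfl | hn
    · simp
    have := ha n hn
    positivity
  have hterm : ∑ n ∈ Finset.Icc 1 M, (n : ℝ) * a n * (1 / (16 * (M : ℝ) ^ 4)) ≤
      ∑ n ∈ Finset.Icc 1 M, a n / (n : ℝ) ^ 3 * (1 - Real.cos (n * (1 / M))) ^ 2 := by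
    apply Finset.sum_le_sum
    intro n hn
    rw [Finset.mem_Icc] at hn
    have hn' : (0 : ℝ) < n := Nat.cast_pos.2 (by omega)
    have hnM : (n : ℝ) ≤ M := by exact_mod_cast hn.2
    have han := ha n hn.1
    have hy0 : 0 < (n : ℝ) * (1 / M) := by positivity
    have hy1 : (n : ℝ) * (1 / M) ≤ 1 := by
      rw [mul_one_div, div_le_one hMpos]; exact hnM
    have hcos := (abs_le.1 (Real.cos_bound (x := (n : ℝ) * (1 / M))
      (by rw [abs_of_pos hy0]; exact hy1))).2
    rw [abs_of_pos hy0] at hcos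
    have hq : ((n : ℝ) * (1 / M)) ^ 4 ≤ ((n : ℝ) * (1 / M)) ^ 2 :=
      pow_le_pow_of_le_one hy0.le hy1 (by norm_num)
    have hlow : ((n : ℝ) * (1 / M)) ^ 2 / 4 ≤ 1 - Real.cos (n * (1 / M)) := by
      have : 0 < ((n : ℝ) * (1 / M)) ^ 2 := by positivity
      nlinarith
    calc (n : ℝ) * a n * (1 / (16 * (M : ℝ) ^ 4))
        = a n / (n : ℝ) ^ 3 * (((n : ℝ) * (1 / M)) ^ 2 / 4) ^ 2 := by
          field_simp; norm_num
      _ ≤ _ := by gcongr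
  have hfin := (hterm.trans hle).trans hS
  rw [← Finset.sum_mul, mul_one_div, div_le_iff₀ (by positivity)] at hfin
  refine hfin.trans (le_of_eq ?_)
  rw [hη]
  field_simp

/-- If a nonnegative MVBV sequence has a sine series converging pointwise to a
continuous (2π-periodic) function, then `n·aₙ → 0`. -/
theorem stmt6 (a : ℕ → ℝ) (ha : ∀ n : ℕ, 1 ≤ n → 0 ≤ a n)
    (hMVBV : IsMVBVS a) (f : ℝ → ℝ)
    (hpt : ∀ x : ℝ,
      Tendsto (fun n : ℕ => ∑ k ∈ Finset.Icc 1 n, a k * Real.sin (k * x))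
        atTop (nhds (f x)))
    (hf : Continuous f) (hper : Function.Periodic f (2 * Real.pi)) :
    Tendsto (fun n : ℕ => (n : ℝ) * a n) atTop (nhds 0) := by
  obtain ⟨lam, hlam, C, hC, hvar⟩ := hMVBV
  have hlam0 : 0 < lam := by linarith
  rw [Metric.tendsto_atTop]
  intro e he
  set ε := e / (2 * ((1 + C) * (2 * lam) * lam)) with hε
  have hε0 : 0 < ε := by positivity
  obtain ⟨M0, hM0⟩ := key_sum a ha f hpt hf ε hε0
  obtain ⟨N1, hN1⟩ := exists_nat_gt (2 * lam)
  refine ⟨M0 + N1 + 1, fun n hn => ?_⟩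
  have hn1 : 1 ≤ n := by omega
  have hn0 : (0 : ℝ) < n := Nat.cast_pos.2 hn1
  have hnlam : 2 * lam < n := hN1.trans (by exact_mod_cast (by omega : N1 < n))
  set p := ⌊(n : ℝ) / lam⌋₊ with hp
  set q := ⌊lam * n⌋₊ with hq
  have hqn : 2 * n ≤ q := by
    apply Nat.le_floor
    push_cast
    nlinarith
  have hpn : p ≤ n := by
    apply Nat.floor_le_of_le
    rw [div_le_iff₀ hlam0]
    nlinarith
  have hp1 : (n : ℝ) / (2 * lam) ≤ p := by
    have h1 := Nat.lt_floor_add_one ((n : ℝ) / lam)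
    rw [← hp] at h1
    have h2 : (1 : ℝ) ≤ n / (2 * lam) := by
      rw [le_div_iff₀ (by positivity)]; linarith
    have h3 : (n : ℝ) / lam = n / (2 * lam) + n / (2 * lam) := by field_simp; norm_num
    linarith
  have hppos : 1 ≤ p := by
    have : (0 : ℝ) < p := lt_of_lt_of_le (by positivity) hp1
    exact_mod_cast this
  have hqle : (q : ℝ) ≤ lam * n := Nat.floor_le (by positivity)
  set W := ∑ k ∈ Finset.Icc p q, a k with hW
  have hWb : (n : ℝ) / (2 * lam) * W ≤ ε * (lam * n) := by
    calc (n : ℝ) / (2 * lam) * W ≤ ∑ k ∈ Finset.Icc p q, (k : ℝ) * a k := by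
          rw [hW, Finset.mul_sum]
          apply Finset.sum_le_sum
          intro k hk
          rw [Finset.mem_Icc] at hk
          have := ha k (by omega)
          have hk' : (p : ℝ) ≤ k := by exact_mod_cast hk.1
          gcongr
          linarith
      _ ≤ ∑ k ∈ Finset.Icc 1 q, (k : ℝ) * a k := by
          apply Finset.sum_le_sum_of_subset_of_nonneg
          · exact Finset.Icc_subset_Icc hppos le_rfl
          · intro k hk _
            rw [Finset.mem_Icc] at hk
            exact mul_nonneg (Nat.cast_nonneg _) (ha k hk.1)
      _ ≤ ε * q := hM0 q (by omega)
      _ ≤ _ := by gcongr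
  have hWb' : W ≤ ε * (2 * lam) * lam := by
    have h1 : (n : ℝ) * W ≤ n * (ε * (2 * lam) * lam) := by
      rw [div_mul_eq_mul_div, div_le_iff₀ (by positivity)] at hWb
      linarith
    exact le_of_mul_le_mul_left h1 hn0
  have hv := hvar n hn1
  rw [← hW] at hv
  set V := ∑ k ∈ Finset.Icc n (2 * n), |a k - a (k + 1)| with hV
  have hstep : ∀ j : ℕ, j ≤ n → a n ≤ a (n + j) + V := by
    intro j hj
    have h1 : a n - a (n + j) = ∑ k ∈ Finset.Ico n (n + j), (a k - a (k + 1)) := by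
      have := Finset.sum_range_sub' (fun i => a (n + i)) j
      rw [Finset.sum_Ico_eq_sum_range]
      simpa [add_assoc] using this.symm
    have h2 : ∑ k ∈ Finset.Ico n (n + j), (a k - a (k + 1)) ≤ V := by
      calc _ ≤ ∑ k ∈ Finset.Ico n (n + j), |a k - a (k + 1)| :=
            Finset.sum_le_sum fun k _ => le_abs_self _
        _ ≤ V := by
            apply Finset.sum_le_sum_of_subset_of_nonneg
            · intro k hk
              simp at hk ⊢; omega
            · intro k _ _; exact abs_nonneg _
    linarith
  have hsum : (n : ℝ) * a n ≤ W + n * V := by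
    calc (n : ℝ) * a n = ∑ j ∈ Finset.range n, a n := by simp
      _ ≤ ∑ j ∈ Finset.range n, (a (n + j) + V) :=
          Finset.sum_le_sum fun j hj => hstep j (Finset.mem_range.1 hj).le
      _ = ∑ k ∈ Finset.Ico n (2 * n), a k + n * V := by
          rw [Finset.sum_add_distrib, Finset.sum_Ico_eq_sum_range]
          simp [two_mul]
      _ ≤ W + n * V := by
          gcongr
          apply Finset.sum_le_sum_of_subset_of_nonneg
          · intro k hk
            simp at hk ⊢; omega
          · intro k hk _
            rw [Finset.mem_Icc] at hk
            exact ha k (by omega)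
  have hnV : n * V ≤ C * W := by
    have := mul_le_mul_of_nonneg_left hv hn0.le
    calc _ ≤ _ := this
      _ = C * W := by field_simp
  have hnn : 0 ≤ (n : ℝ) * a n := mul_nonneg hn0.le (ha n hn1)
  rw [Real.dist_eq, sub_zero, abs_of_nonneg hnn]
  have hC1 : (1 + C) * W ≤ (1 + C) * (ε * (2 * lam) * lam) := by gcongr
  have hval : (1 + C) * (ε * (2 * lam) * lam) = e / 2 := by
    rw [hε]; field_simp
  linarith
end

section
/- Let {M_n}_{n≥1} be a nonnegative increasing sequence with M_n → ∞. Then there exists a nonnegative real sequence {a_n}_{n≥1} with lim_{n→∞} n·a_n = 0 such that for every real number λ ≥ 2, lim_{n→∞} (∑_{k=n}^{2n} |a_k − a_{k+1}|) / ((M_n/n)·∑_{k=⌊n/λ⌋}^{⌊λn⌋} a_k) = 0, but the sine series ∑_{n=1}^∞ a_n sin(nx) does not converge uniformly on ℝ (i.e., its partial sums S_n(x) = ∑_{k=1}^n a_k sin(kx) do not converge uniformly). -/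
open Filter

/-- the bump factor -/
noncomputable def bump (p R : ℕ) (k : ℕ) : ℝ :=
  if k ≤ 4 * p * R then max (Real.sin (k * (Real.pi / (2 * p)))) 0 else 0

lemma bump_nonneg (p R k : ℕ) : 0 ≤ bump p R k := by
  unfold bump; split_ifs
  · exact le_max_right _ _
  · exact le_rfl

lemma bump_le_one (p R k : ℕ) : bump p R k ≤ 1 := by
  unfold bump; split_ifs
  · exact max_le (Real.sin_le_one _) zero_le_one
  · exact zero_le_one

lemma bump_mul (p R : ℕ) (hp : 0 < p) (i : ℕ) : bump p R (4 * p * i) = 0 := by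
  have hp' : (p : ℝ) ≠ 0 := by positivity
  unfold bump; split_ifs
  · have : ((4 * p * i : ℕ) : ℝ) * (Real.pi / (2 * p)) = ((2 * i : ℕ) : ℝ) * Real.pi := by
      push_cast; field_simp; ring
    rw [this, Real.sin_nat_mul_pi]; simp
  · rfl

lemma bump_zero_of_ge (p R : ℕ) (hp : 0 < p) (k : ℕ) (h : 4 * p * R ≤ k) : bump p R k = 0 := by
  rcases h.eq_or_lt with h | h
  · rw [← h]; exact bump_mul p R hp R
  · unfold bump; rw [if_neg (by omega)]

lemma bump_diff (p R : ℕ) (hp : 0 < p) (k : ℕ) :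
    (k : ℝ) * |bump p R k - bump p R (k + 1)| ≤ 8 * R := by
  have hp' : (0 : ℝ) < p := by positivity
  rcases le_or_gt (4 * p * R) k with h | h
  · rw [bump_zero_of_ge p R hp k h, bump_zero_of_ge p R hp (k + 1) (by omega)]; simp
  · have h1 : |bump p R k - bump p R (k + 1)| ≤ Real.pi / (2 * p) := by
      unfold bump
      rw [if_pos (by omega), if_pos (by omega)]
      refine (abs_max_sub_max_le_abs _ _ _).trans ?_
      have hl := Real.abs_sin_sub_sin_le ((k : ℝ) * (Real.pi / (2 * p))) (((k + 1 : ℕ) : ℝ) * (Real.pi / (2 * p)))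
      refine hl.trans ?_
      rw [← sub_mul]
      push_cast
      rw [abs_mul, show (k : ℝ) - (k + 1) = -1 by ring, abs_neg, abs_one, one_mul, abs_of_pos]
      have := Real.pi_pos
      positivity
    have h2 : Real.pi / (2 * p) ≤ 2 / p := by
      rw [div_le_div_iff₀ (by positivity) hp']
      nlinarith [Real.pi_le_four]
    have h3 : (k : ℝ) ≤ 4 * p * R := by exact_mod_cast h.le
    calc (k : ℝ) * |bump p R k - bump p R (k + 1)| ≤ (4 * p * R) * (2 / p) := by
          apply mul_le_mul h3 (h1.trans h2) (abs_nonneg _) (by positivity)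
      _ = 8 * R := by field_simp; ring

lemma sum_sin_sq (p : ℕ) (hp : 0 < p) :
    ∑ l ∈ Finset.range (2 * p), Real.sin (l * (Real.pi / (2 * p))) ^ 2 = p := by
  have hp' : (p : ℝ) ≠ 0 := by positivity
  rw [two_mul, Finset.sum_range_add, ← Finset.sum_add_distrib]
  have : ∀ l ∈ Finset.range p, Real.sin (l * (Real.pi / (2 * p))) ^ 2 +
      Real.sin ((p + l : ℕ) * (Real.pi / (2 * p))) ^ 2 = 1 := by
    intro l _
    have : ((p + l : ℕ) : ℝ) * (Real.pi / (2 * p)) = l * (Real.pi / (2 * p)) + Real.pi / 2 := by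
      push_cast; field_simp; ring
    rw [this, Real.sin_add_pi_div_two, Real.sin_sq_add_cos_sq]
  rw [Finset.sum_congr rfl this]; simp

/-- one period -/
lemma period_sum (p R : ℕ) (hp : 0 < p) (i : ℕ) (hi1 : 1 ≤ i) (hi : i < R) :
    (1 : ℝ) / (4 * (i + 1)) ≤ ∑ l ∈ Finset.range (4 * p),
      (1 / ((4 * p * i + l : ℕ) : ℝ)) * (1 + bump p R (4 * p * i + l)) *
        Real.sin ((4 * p * i + l : ℕ) * (Real.pi / (2 * p))) := by
  have hp' : (0 : ℝ) < p := by positivity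
  have hi' : (1 : ℝ) ≤ i := by exact_mod_cast hi1
  rw [show 4 * p = 2 * p + 2 * p by ring, Finset.sum_range_add, ← Finset.sum_add_distrib,
    show 2 * p + 2 * p = 4 * p by ring]
  have key : ∀ l ∈ Finset.range (2 * p),
      (1 / (4 * p * (i + 1)) : ℝ) * Real.sin (l * (Real.pi / (2 * p))) ^ 2 ≤
      (1 / ((4 * p * i + l : ℕ) : ℝ)) * (1 + bump p R (4 * p * i + l)) *
        Real.sin ((4 * p * i + l : ℕ) * (Real.pi / (2 * p))) +
      (1 / ((4 * p * i + (2 * p + l) : ℕ) : ℝ)) * (1 + bump p R (4 * p * i + (2 * p + l))) *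
        Real.sin ((4 * p * i + (2 * p + l) : ℕ) * (Real.pi / (2 * p))) := by
    intro l hl
    have hl' : l < 2 * p := Finset.mem_range.1 hl
    have hlr : (l : ℝ) ≤ 2 * p := by exact_mod_cast hl'.le
    have hle : 4 * p * i + 4 * p ≤ 4 * p * R := by
      calc 4 * p * i + 4 * p = 4 * p * (i + 1) := by ring
        _ ≤ 4 * p * R := Nat.mul_le_mul_left _ hi
    set s := Real.sin (l * (Real.pi / (2 * p))) with hs
    have hs0 : 0 ≤ s := by
      apply Real.sin_nonneg_of_nonneg_of_le_pi
      · have := Real.pi_pos; positivity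
      · calc (l : ℝ) * (Real.pi / (2 * p)) ≤ (2 * p) * (Real.pi / (2 * p)) := by
              have := Real.pi_pos; gcongr
          _ = Real.pi := by field_simp
    have e1 : Real.sin ((4 * p * i + l : ℕ) * (Real.pi / (2 * p))) = s := by
      have : ((4 * p * i + l : ℕ) : ℝ) * (Real.pi / (2 * p)) =
          l * (Real.pi / (2 * p)) + i * (2 * Real.pi) := by
        push_cast; field_simp; ring
      rw [this, Real.sin_add_nat_mul_two_pi]
    have e2 : Real.sin ((4 * p * i + (2 * p + l) : ℕ) * (Real.pi / (2 * p))) = -s := by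
      have : ((4 * p * i + (2 * p + l) : ℕ) : ℝ) * (Real.pi / (2 * p)) =
          (l * (Real.pi / (2 * p)) + Real.pi) + i * (2 * Real.pi) := by
        push_cast; field_simp; ring
      rw [this, Real.sin_add_nat_mul_two_pi, Real.sin_add_pi]
    have b1 : bump p R (4 * p * i + l) = s := by
      unfold bump
      rw [if_pos (by omega), e1, max_eq_left hs0]
    have b2 : bump p R (4 * p * i + (2 * p + l)) = 0 := by
      unfold bump
      rw [if_pos (by omega), e2, max_eq_right (by linarith)]
    rw [e1, e2, b1, b2]
    push_cast
    have hA : (0 : ℝ) < 4 * p * i + l := by positivity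
    have h1 : (1 : ℝ) / (4 * p * i + (2 * p + l)) ≤ 1 / (4 * p * i + l) := by
      apply one_div_le_one_div_of_le hA; linarith
    have h2 : (1 : ℝ) / (4 * p * (i + 1)) ≤ 1 / (4 * p * i + l) := by
      apply one_div_le_one_div_of_le hA; nlinarith
    have h3 := mul_le_mul_of_nonneg_right h2 (sq_nonneg s)
    have h4 := mul_le_mul_of_nonneg_right h1 hs0
    nlinarith
  refine le_trans (le_of_eq ?_) (Finset.sum_le_sum key)
  rw [← Finset.mul_sum, sum_sin_sq p hp]
  field_simp

lemma block_sum (p R : ℕ) (hp : 0 < p) (n : ℕ) (hn : n + 1 ≤ R) :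
    (1 / 4 : ℝ) * ∑ i ∈ Finset.range n, (1 : ℝ) / ((i + 1 : ℕ) + 1) ≤
      ∑ k ∈ Finset.Ico (4 * p) (4 * p * (n + 1)),
      (1 / (k : ℝ)) * (1 + bump p R k) * Real.sin (k * (Real.pi / (2 * p))) := by
  induction n with
  | zero => simp
  | succ n ih =>
    rw [Finset.sum_range_succ, mul_add]
    have hh := period_sum p R hp (n + 1) (by omega) (by omega)
    rw [← Finset.sum_Ico_consecutive _ (show 4 * p ≤ 4 * p * (n + 1) by nlinarith)
      (show 4 * p * (n + 1) ≤ 4 * p * (n + 1 + 1) by nlinarith)]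
    refine add_le_add (ih (by omega)) ?_
    rw [Finset.sum_Ico_eq_sum_range, show 4 * p * (n + 1 + 1) - 4 * p * (n + 1) = 4 * p by
      rw [← Nat.mul_sub]; simp]
    refine le_trans (le_of_eq ?_) hh
    field_simp

lemma exists_R : ∃ R : ℕ → ℕ, ∀ j : ℕ,
    ((j : ℝ) + 1) ≤ (1 / 4 : ℝ) * ∑ i ∈ Finset.range (R j), (1 : ℝ) / ((i + 1 : ℕ) + 1) := by
  have h := Real.tendsto_sum_range_one_div_nat_succ_atTop
  have : ∀ j : ℕ, ∃ R : ℕ,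
      ((j : ℝ) + 1) ≤ (1 / 4 : ℝ) * ∑ i ∈ Finset.range R, (1 : ℝ) / ((i + 1 : ℕ) + 1) := by
    intro j
    obtain ⟨n, hn, hn1⟩ := ((h.eventually_ge_atTop (4 * ((j : ℝ) + 1) + 1)).and
      (eventually_ge_atTop 1)).exists
    obtain ⟨m, rfl⟩ : ∃ m, n = m + 1 := ⟨n - 1, by omega⟩
    refine ⟨m, ?_⟩
    rw [Finset.sum_range_succ'] at hn
    simp only [Nat.cast_zero, zero_add, div_one] at hn
    linarith
  choose R hR using this
  exact ⟨R, hR⟩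

lemma exists_p (M : ℕ → ℝ) (hMtop : Tendsto M atTop atTop) (R : ℕ → ℕ) :
    ∃ p : ℕ → ℕ, (∀ j, 0 < p j) ∧ (∀ j, p j * (R j + 1) < p (j + 1)) ∧
      ∀ j : ℕ, ((j : ℝ) + 1) * (R j + 1 : ℕ) ≤ M (2 * p j) := by
  have : ∀ j N : ℕ, ∃ q : ℕ, N < q ∧ ((j : ℝ) + 1) * (R j + 1 : ℕ) ≤ M (2 * q) := by
    intro j N
    have h2 : Tendsto (fun q : ℕ => 2 * q) atTop atTop :=
      tendsto_id.const_mul_atTop' (by norm_num)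
    exact ((eventually_gt_atTop N).and ((hMtop.comp h2).eventually_ge_atTop _)).exists
  choose F hF1 hF2 using this
  let p : ℕ → ℕ := fun j => Nat.rec (F 0 0) (fun j q => F (j + 1) (q * (R j + 1))) j
  have hs : ∀ j, p (j + 1) = F (j + 1) (p j * (R j + 1)) := fun j => rfl
  refine ⟨p, ?_, ?_, ?_⟩
  · rintro (_ | j)
    · exact hF1 0 0
    · rw [hs]; exact lt_of_le_of_lt (Nat.zero_le _) (hF1 _ _)
  · intro j; rw [hs]; exact hF1 _ _
  · rintro (_ | j)
    · exact hF2 0 0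
    · rw [hs]; exact hF2 _ _

lemma exists_J (L : ℕ → ℕ) (hL : StrictMono L) :
    ∃ J : ℕ → ℕ, Monotone J ∧ (∀ j k, L j ≤ k → j ≤ J k) ∧
      (∀ k, L 0 ≤ k → L (J k) ≤ k) ∧ ∀ k, k < L (J k + 1) := by
  have h1 : ∀ j k, L j ≤ k → j ≤ Nat.findGreatest (fun j => L j ≤ k) k := by
    intro j k h
    exact Nat.le_findGreatest ((hL.id_le j).trans h) h
  refine ⟨fun k => Nat.findGreatest (fun j => L j ≤ k) k, ?_, h1, ?_, ?_⟩
  · intro k k' h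
    exact Nat.findGreatest_mono (fun j hj => le_trans hj h) h
  · intro k h
    exact Nat.findGreatest_spec (P := fun j => L j ≤ k) (Nat.zero_le k) h
  · intro k
    by_contra! h
    have := h1 _ _ h
    omega

theorem stmt9 (M : ℕ → ℝ) (hM0 : ∀ n : ℕ, 0 ≤ M n) (hMmono : Monotone M)
    (hMtop : Tendsto M atTop atTop) :
    ∃ a : ℕ → ℝ,
      (∀ n : ℕ, 1 ≤ n → 0 ≤ a n) ∧
      Tendsto (fun n : ℕ => (n : ℝ) * a n) atTop (nhds 0) ∧
      (∀ lam : ℝ, 2 ≤ lam →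
        Tendsto
          (fun n : ℕ =>
            (∑ k ∈ Finset.Icc n (2 * n), |a k - a (k + 1)|) /
              ((M n / n) * ∑ k ∈ Finset.Icc ⌊(n : ℝ) / lam⌋₊ ⌊lam * n⌋₊, a k))
          atTop (nhds 0)) ∧
      ¬ ∃ f : ℝ → ℝ,
        TendstoUniformly
          (fun (n : ℕ) (x : ℝ) => ∑ k ∈ Finset.Icc 1 n, a k * Real.sin (k * x))
          f atTop := by
  obtain ⟨R, hR⟩ := exists_R
  obtain ⟨p, hp0, hpR, hpM⟩ := exists_p M hMtop R
  have hL : StrictMono (fun j => 4 * p j) := by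
    apply strictMono_nat_of_lt_succ
    intro j
    have := hpR j
    have : p j * 1 ≤ p j * (R j + 1) := Nat.mul_le_mul_left _ (by omega)
    omega
  obtain ⟨J, hJmono, hJ1, hJ2, hJ3⟩ := exists_J _ hL
  have hJtop : Tendsto J atTop atTop := by
    apply tendsto_atTop.2
    intro j
    filter_upwards [eventually_ge_atTop (4 * p j)] with k hk using hJ1 j k hk
  let e : ℕ → ℝ := fun k => 1 / ((J k : ℝ) + 1)
  let b : ℕ → ℝ := fun k => e k * (1 / (k : ℝ))
  let g : ℕ → ℝ := fun k => bump (p (J k)) (R (J k) + 1) k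
  have he0 : ∀ k, 0 < e k := fun k => by simp only [e]; positivity
  have heanti : ∀ k l, k ≤ l → e l ≤ e k := by
    intro k l h
    simp only [e]
    have : (J k : ℝ) ≤ J l := by exact_mod_cast hJmono h
    gcongr
  have hetend : Tendsto e atTop (nhds 0) := tendsto_one_div_add_atTop_nhds_zero_nat.comp hJtop
  have hb0 : ∀ k, 0 ≤ b k := fun k => mul_nonneg (he0 k).le (by positivity)
  have hbanti : ∀ k l, 1 ≤ k → k ≤ l → b l ≤ b k := by
    intro k l hk h
    have hk' : (0 : ℝ) < k := by positivity
    have h' : (k : ℝ) ≤ l := by exact_mod_cast h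
    exact mul_le_mul (heanti k l h) (one_div_le_one_div_of_le hk' h') (by positivity) (he0 k).le
  have hg0 : ∀ k, 0 ≤ g k := fun k => bump_nonneg _ _ _
  have hg1 : ∀ k, g k ≤ 1 := fun k => bump_le_one _ _ _
  have hgdiff : ∀ k, 4 * p 0 ≤ k → (k : ℝ) * |g k - g (k + 1)| ≤ 8 * (e k * M (k / 2)) := by
    intro k hk
    have hkk := hJ2 k hk
    by_cases hj : J (k + 1) = J k
    · have h1 := bump_diff (p (J k)) (R (J k) + 1) (hp0 _) k
      simp only [g]
      rw [hj]
      refine h1.trans ?_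
      have h2 := hpM (J k)
      have h3 : M (2 * p (J k)) ≤ M (k / 2) := hMmono (by omega)
      have h4 : ((R (J k) + 1 : ℕ) : ℝ) ≤ e k * M (k / 2) := by
        simp only [e]
        rw [one_div_mul_eq_div, le_div_iff₀ (by positivity)]
        linarith
      linarith
    · have hlt : J k < J (k + 1) := lt_of_le_of_ne (hJmono (by omega)) (Ne.symm hj)
      have h5 := hJ3 k
      have h6 := hJ2 (k + 1) (by omega)
      have h7 : 4 * p (J k + 1) ≤ 4 * p (J (k + 1)) := hL.monotone hlt
      have h8 : k + 1 = 4 * p (J (k + 1)) := by omega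
      have hA : g (k + 1) = 0 := by
        have := bump_mul (p (J (k + 1))) (R (J (k + 1)) + 1) (hp0 _) 1
        rw [mul_one, ← h8] at this
        exact this
      have hB : g k = 0 := by
        apply bump_zero_of_ge _ _ (hp0 _)
        have := hpR (J k)
        rw [mul_assoc]
        omega
      rw [hA, hB]
      simp only [sub_zero, abs_zero, mul_zero]
      have := hM0 (k / 2)
      have := (he0 k).le
      positivity
  have ha0 : ∀ k, 0 ≤ b k * (1 + g k) := fun k => mul_nonneg (hb0 k) (by linarith [hg0 k])
  refine ⟨fun k => b k * (1 + g k), fun n _ => ha0 n, ?_, ?_, ?_⟩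
  · have h2 : Tendsto (fun n => 2 * e n) atTop (nhds 0) := by simpa using hetend.const_mul 2
    refine squeeze_zero' (Eventually.of_forall fun n => mul_nonneg (by positivity) (ha0 n)) ?_ h2
    filter_upwards [eventually_ge_atTop 1] with n hn
    have hn' : (0 : ℝ) < n := by positivity
    have : (n : ℝ) * (b n * (1 + g n)) = e n * (1 + g n) := by
      simp only [b]; field_simp
    rw [this]
    nlinarith [hg1 n, he0 n]
  · intro lam hlam
    have h2 : Tendsto (fun n => 4 / M n + 32 * e n) atTop (nhds 0) := by
      have h3 : Tendsto (fun n => 4 / M n) atTop (nhds 0) := hMtop.const_div_atTop 4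
      simpa using h3.add (hetend.const_mul 32)
    refine squeeze_zero' (Eventually.of_forall fun n => ?_) ?_ h2
    · apply div_nonneg (Finset.sum_nonneg fun _ _ => abs_nonneg _)
      exact mul_nonneg (div_nonneg (hM0 n) (by positivity)) (Finset.sum_nonneg fun k _ => ha0 k)
    filter_upwards [eventually_ge_atTop 1, eventually_ge_atTop (4 * p 0),
      hMtop.eventually_gt_atTop 0] with n hn hnp hMn
    have hn' : (1 : ℝ) ≤ n := by exact_mod_cast hn
    have hbn : 0 < b n := mul_pos (he0 n) (by positivity)
    have hnum : ∑ k ∈ Finset.Icc n (2 * n), |b k * (1 + g k) - b (k + 1) * (1 + g (k + 1))| ≤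
        b n * (2 + 16 * (e n * M n)) := by
      have hpt : ∀ k ∈ Finset.Icc n (2 * n),
          |b k * (1 + g k) - b (k + 1) * (1 + g (k + 1))| ≤
          2 * (b k - b (k + 1)) + b n * (8 * (e n * M n) / n) := by
        intro k hk
        rw [Finset.mem_Icc] at hk
        have hkn : (n : ℝ) ≤ k := by exact_mod_cast hk.1
        have hd := hgdiff k (by omega)
        have hd2 : |g k - g (k + 1)| ≤ 8 * (e n * M n) / n := by
          rw [le_div_iff₀ (by linarith)]
          have h5 : e k * M (k / 2) ≤ e n * M n :=
            mul_le_mul (heanti n k hk.1) (hMmono (by omega)) (hM0 _) (he0 n).le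
          have h6 := mul_le_mul_of_nonneg_right hkn (abs_nonneg (g k - g (k + 1)))
          linarith
        have hbb := hbanti k (k + 1) (by omega) (by omega)
        have hbb' := hbanti n k hn hk.1
        have hsplit : b k * (1 + g k) - b (k + 1) * (1 + g (k + 1)) =
            (b k - b (k + 1)) * (1 + g (k + 1)) + b k * (g k - g (k + 1)) := by ring
        rw [hsplit]
        refine (abs_add_le _ _).trans (add_le_add ?_ ?_)
        · rw [abs_of_nonneg (mul_nonneg (by linarith) (by linarith [hg0 (k + 1)]))]
          nlinarith [hg1 (k + 1)]
        · rw [abs_mul, abs_of_nonneg (hb0 k)]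
          exact mul_le_mul hbb' hd2 (abs_nonneg _) hbn.le
      refine (Finset.sum_le_sum hpt).trans ?_
      rw [Finset.sum_add_distrib, ← Finset.mul_sum, Finset.sum_const, Nat.card_Icc]
      have htel : ∑ k ∈ Finset.Icc n (2 * n), (b k - b (k + 1)) = b n - b (2 * n + 1) := by
        rw [← Finset.Ico_add_one_right_eq_Icc, Finset.sum_Ico_eq_sum_range]
        have := Finset.sum_range_sub' (fun i => b (n + i)) (2 * n + 1 - n)
        rw [add_zero, show n + (2 * n + 1 - n) = 2 * n + 1 by omega] at this
        exact this
      rw [htel, show 2 * n + 1 - n = n + 1 by omega, nsmul_eq_mul]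
      have hq : ((n + 1 : ℕ) : ℝ) * (b n * (8 * (e n * M n) / n)) ≤ b n * (16 * (e n * M n)) := by
        have h7 : ((n + 1 : ℕ) : ℝ) / n ≤ 2 := by
          rw [div_le_iff₀ (by linarith)]; push_cast; linarith
        have h8 : 0 ≤ b n * (8 * (e n * M n)) := by
          have := he0 n
          positivity
        calc _ = ((n + 1 : ℕ) : ℝ) / n * (b n * (8 * (e n * M n))) := by ring
          _ ≤ 2 * (b n * (8 * (e n * M n))) := mul_le_mul_of_nonneg_right h7 h8
          _ = _ := by ring
      linarith [hb0 (2 * n + 1)]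
    have hden : (n : ℝ) / 2 * b n ≤
        ∑ k ∈ Finset.Icc ⌊(n : ℝ) / lam⌋₊ ⌊lam * n⌋₊, b k * (1 + g k) := by
      have hsub : Finset.Icc ((n + 1) / 2) n ⊆ Finset.Icc ⌊(n : ℝ) / lam⌋₊ ⌊lam * n⌋₊ := by
        apply Finset.Icc_subset_Icc
        · have h9 : (n : ℝ) / lam ≤ (n : ℝ) / (2 : ℕ) := by
            push_cast
            gcongr
          have := Nat.floor_le_floor h9
          rw [Nat.floor_div_eq_div] at this
          omega
        · apply Nat.le_floor
          nlinarith
      refine le_trans ?_ (Finset.sum_le_sum_of_subset_of_nonneg hsub (fun k _ _ => ha0 k))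
      have hc : ∀ k ∈ Finset.Icc ((n + 1) / 2) n, b n ≤ b k * (1 + g k) := by
        intro k hk
        rw [Finset.mem_Icc] at hk
        have := hbanti k n (by omega) hk.2
        nlinarith [hb0 k, hg0 k, mul_nonneg (hb0 k) (hg0 k)]
      refine le_trans ?_ (Finset.card_nsmul_le_sum _ _ _ hc)
      rw [Nat.card_Icc, nsmul_eq_mul]
      apply mul_le_mul_of_nonneg_right _ hbn.le
      have h10 : n ≤ (n + 1 - (n + 1) / 2) * 2 := by omega
      rw [div_le_iff₀ (by norm_num)]
      exact_mod_cast h10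
    have hden2 : M n * b n / 2 ≤
        (M n / n) * ∑ k ∈ Finset.Icc ⌊(n : ℝ) / lam⌋₊ ⌊lam * n⌋₊, b k * (1 + g k) := by
      have := mul_le_mul_of_nonneg_left hden (show 0 ≤ M n / n by positivity)
      refine le_trans (le_of_eq ?_) this
      field_simp
    have hpos : 0 < M n * b n / 2 := by positivity
    calc _ ≤ (b n * (2 + 16 * (e n * M n))) / (M n * b n / 2) := by
          apply div_le_div₀ _ hnum hpos hden2
          have := he0 n
          positivity
      _ = 4 / M n + 32 * e n := by field_simp; ring
  · rintro ⟨f, hf⟩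
    rw [Metric.tendstoUniformly_iff] at hf
    obtain ⟨N, hN⟩ := eventually_atTop.1 (hf (1 / 2) (by norm_num))
    have hNj : N + 1 ≤ 4 * p (N + 1) := hL.id_le (N + 1)
    set j := N + 1 with hjdef
    set x : ℝ := Real.pi / (2 * p j) with hx
    have hend : 4 * p j ≤ 4 * p j * (R j + 1) := Nat.le_mul_of_pos_right _ (by omega)
    have h1 := hN (4 * p j - 1) (by omega) x
    have h2 := hN (4 * p j * (R j + 1) - 1) (by omega) x
    rw [Real.dist_eq, abs_lt] at h1 h2
    have hblock := block_sum (p j) (R j + 1) (hp0 j) (R j) le_rfl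
    have hIcc : ∀ n, 1 ≤ n → Finset.Icc 1 (n - 1) = Finset.Ico 1 n := by
      intro n hn
      ext k; simp only [Finset.mem_Icc, Finset.mem_Ico]; omega
    rw [hIcc _ (by omega)] at h1 h2
    rw [← Finset.sum_Ico_consecutive _ (show 1 ≤ 4 * p j by omega) hend] at h2
    have heq : ∑ k ∈ Finset.Ico (4 * p j) (4 * p j * (R j + 1)),
        b k * (1 + g k) * Real.sin (k * x) = (1 / ((j : ℝ) + 1)) *
        ∑ k ∈ Finset.Ico (4 * p j) (4 * p j * (R j + 1)),
        (1 / (k : ℝ)) * (1 + bump (p j) (R j + 1) k) * Real.sin (k * (Real.pi / (2 * p j))) := by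
      rw [Finset.mul_sum]
      apply Finset.sum_congr rfl
      intro k hk
      rw [Finset.mem_Ico] at hk
      have hJk : J k = j := by
        apply le_antisymm _ (hJ1 j k hk.1)
        by_contra! hc
        have h3 : 4 * p (j + 1) ≤ 4 * p (J k) := hL.monotone hc
        have h4 := hJ2 k (le_trans (hL.monotone (Nat.zero_le j)) hk.1)
        have h5 := hpR j
        have h6 := hk.2
        rw [mul_assoc] at h6
        omega
      simp only [b, g, e, hJk]
      ring
    have hge : 1 ≤ (1 / ((j : ℝ) + 1)) *
        ∑ k ∈ Finset.Ico (4 * p j) (4 * p j * (R j + 1)),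
        (1 / (k : ℝ)) * (1 + bump (p j) (R j + 1) k) * Real.sin (k * (Real.pi / (2 * p j))) := by
      rw [one_div_mul_eq_div, le_div_iff₀ (by positivity), one_mul]
      exact (hR j).trans hblock
    rw [← heq] at hge
    linarith [h1.1, h1.2, h2.1, h2.2]
end
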